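/- Let π be a dominant integral weight with Stab_W(π) = W_P, and let v ≤ w be π-minuscule elements in W^P. Fix a reduced expression w = s_{i_1} s_{i_2} ⋯ s_{i_ℓ} and set β_j = s_{i_1}⋯s_{i_{j−1}}(α_{i_j}) for 1 ≤ j ≤ ℓ. Then #Red(w v^{−1}) = (ℓ(w) − ℓ(v))! · (Σ ht(β_{j_1}) ht(β_{j_2}) ⋯ ht(β_{j_{ℓ(v)}})) / (ht(β_1) ⋯ ht(β_ℓ)), where the sum is over all subsequences 1 ≤ j_1 < j_2 < ⋯ < j_{ℓ(v)} ≤ ℓ such that v = s_{i_{j_1}} s_{i_{j_2}} ⋯ s_{i_{j_{ℓ(v)}}} is a reduced decomposition of v. -/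

import Mathlib

open scoped Classical BigOperators

/-- A bundled setting for a finite crystallographic root system together with its
Weyl group, its action on the rational span of the weight lattice, reflections,
and the data of coefficients of roots in the basis of simple roots. -/
structure WeylSetting where
  /-- index set of the Dynkin diagram (simple roots) -/
  I : Type
  [fintypeI : Fintype I]
  [decEqI : DecidableEq I]
  /-- rational span of the weight lattice -/
  V : Type
  [acg : AddCommGroup V]
  [mod : Module ℚ V]
  /-- the Weyl group -/
  W : Type
  [grp : Group W]
  /-- the action of the Weyl group on weights -/
  act : W →* (V ≃ₗ[ℚ] V)
  /-- the simple roots -/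
  simple : I → V
  /-- the (finite) set of roots -/
  roots : Finset V
  /-- `coroot β μ` is the pairing `⟨μ, β∨⟩` -/
  coroot : V → (V →ₗ[ℚ] ℚ)
  /-- the reflection `s_β ∈ W` associated to a root `β` -/
  srefl : V → W
  /-- coefficients of a positive root in the basis of simple roots -/
  posCoeff : V → I → ℕ
  simple_mem : ∀ i, simple i ∈ roots
  simple_indep : LinearIndependent ℚ simple
  roots_neg : ∀ β ∈ roots, -β ∈ roots
  root_pos_or_neg : ∀ β ∈ roots,
    (∃ c : I → ℚ, (∀ i, 0 ≤ c i) ∧ β = ∑ i, c i • simple i) ∨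
    (∃ c : I → ℚ, (∀ i, 0 ≤ c i) ∧ -β = ∑ i, c i • simple i)
  coroot_self : ∀ β ∈ roots, coroot β β = 2
  crystallographic : ∀ β ∈ roots, ∀ γ ∈ roots, ∃ n : ℤ, coroot β γ = n
  posCoeff_spec : ∀ β ∈ roots,
    (∃ c : I → ℚ, (∀ i, 0 ≤ c i) ∧ β = ∑ i, c i • simple i) →
    β = ∑ i, (posCoeff β i : ℚ) • simple i
  srefl_apply : ∀ β ∈ roots, ∀ v : V, act (srefl β) v = v - coroot β v • β
  act_faithful : ∀ g : W, (∀ v : V, act g v = v) → g = 1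
  roots_invariant : ∀ g : W, ∀ β ∈ roots, act g β ∈ roots
  coroot_equivariant : ∀ g : W, ∀ β ∈ roots, ∀ v : V,
    coroot (act g β) (act g v) = coroot β v
  generated : ∀ g : W, ∃ l : List I, g = (l.map fun i => srefl (simple i)).prod

namespace WeylSetting

attribute [instance] fintypeI decEqI acg mod grp

variable (D : WeylSetting)

/-- the simple reflection attached to a node of the Dynkin diagram -/
def s (i : D.I) : D.W := D.srefl (D.simple i)

/-- the product `s_{i_1} ⋯ s_{i_r}` of the simple reflections listed in `l` -/
def wordProd (l : List D.I) : D.W := (l.map D.s).prod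

/-- `β` is a positive root: a root which is a nonnegative combination of simple roots -/
def IsPosRoot (β : D.V) : Prop :=
  β ∈ D.roots ∧ ∃ c : D.I → ℚ, (∀ i, 0 ≤ c i) ∧ β = ∑ i, c i • D.simple i

/-- the length of a Weyl group element -/
noncomputable def length (g : D.W) : ℕ :=
  sInf {n | ∃ l : List D.I, l.length = n ∧ D.wordProd l = g}

/-- `l` is a reduced word for `g` -/
def IsReduced (l : List D.I) (g : D.W) : Prop :=
  D.wordProd l = g ∧ l.length = D.length g

/-- the number of reduced words of `g` -/
noncomputable def RedCard (g : D.W) : ℕ := Nat.card {l : List D.I // D.IsReduced l g}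

/-- the (strong) Bruhat order on the Weyl group -/
def bruhatLE : D.W → D.W → Prop :=
  Relation.ReflTransGen
    (fun a b => (∃ β, D.IsPosRoot β ∧ b = D.srefl β * a) ∧ D.length a < D.length b)

/-- strict (strong) Bruhat order -/
def bruhatLT (a b : D.W) : Prop := D.bruhatLE a b ∧ a ≠ b

/-- the left weak Bruhat order: `a ≤_L b` iff `ℓ(b a⁻¹) + ℓ(a) = ℓ(b)` -/
def weakLE (a b : D.W) : Prop := D.length (b * a⁻¹) + D.length a = D.length b

/-- the height of a positive root: the sum of its coefficients in the simple roots -/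
noncomputable def ht (β : D.V) : ℕ := ∑ i, D.posCoeff β i

/-- an integral weight: the pairings with all positive coroots are integers -/
def IsIntegral (lam : D.V) : Prop :=
  ∀ β, D.IsPosRoot β → ∃ n : ℤ, D.coroot β lam = n

/-- a dominant integral weight -/
def IsDominant (lam : D.V) : Prop :=
  D.IsIntegral lam ∧ ∀ i, 0 ≤ D.coroot (D.simple i) lam

/-- a pre-dominant integral weight: `⟨λ, β∨⟩ ≥ -1` for all positive roots `β` -/
def IsPreDominant (lam : D.V) : Prop :=
  D.IsIntegral lam ∧ ∀ β, D.IsPosRoot β → -1 ≤ D.coroot β lam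

/-- the diagram `D(λ) = {β ∈ R⁺ : ⟨λ, β∨⟩ = -1}` of a pre-dominant weight -/
noncomputable def diagram (lam : D.V) : Finset D.V :=
  D.roots.filter fun β => D.IsPosRoot β ∧ D.coroot β lam = -1

/-- `IsWeightPath λ [β₁, …, β_r]` says that
`λ = λ₀ →β₁ λ₁ →β₂ ⋯ →β_r λ_r` is a `λ`-path, i.e. each `β_j` is a positive
root, `⟨λ_{j-1}, β_j∨⟩ = -1` and `λ_j = s_{β_j}(λ_{j-1})`. -/
def IsWeightPath : D.V → List D.V → Prop
  | _, [] => True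
  | lam, β :: rest =>
      D.IsPosRoot β ∧ D.coroot β lam = -1 ∧
        IsWeightPath (D.act (D.srefl β) lam) rest

/-- the term `1/β₁ ⋅ 1/(β₁+β₂) ⋅ … ⋅ 1/(β₁+⋯+β_r)` attached to a path
`(β₁, …, β_r)`, computed in a field `F` via a linear embedding `emb`. -/
noncomputable def pathTerm {F : Type} [Field F] [Algebra ℚ F]
    (emb : D.V →ₗ[ℚ] F) (l : List D.V) : F :=
  ∏ j ∈ Finset.range l.length, (emb ((l.take (j + 1)).sum))⁻¹

/-- `w` is a π-minuscule element (in the sense of Peterson). -/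
def IsMinuscule (pi : D.V) (w : D.W) : Prop :=
  ∃ l : List D.I, D.IsReduced l w ∧
    ∀ k : Fin l.length,
      D.coroot (D.simple (l.get k)) (D.act (D.wordProd (l.drop (k.val + 1))) pi) = 1

/-- the stabilizer `W_π = Stab_W(π)` of a weight -/
def stab (pi : D.V) : Subgroup D.W where
  carrier := {g | D.act g pi = pi}
  one_mem' := by simp
  mul_mem' := by
    intro a b ha hb
    simp only [Set.mem_setOf_eq] at *
    calc D.act (a * b) pi = D.act a (D.act b pi) := by rw [map_mul]; rfl
    _ = pi := by rw [hb, ha]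
  inv_mem' := by
    intro a ha
    simp only [Set.mem_setOf_eq] at *
    calc D.act a⁻¹ pi = D.act a⁻¹ (D.act a pi) := by rw [ha]
    _ = D.act (a⁻¹ * a) pi := by rw [map_mul]; rfl
    _ = pi := by simp

/-- `u` is the minimal-length representative of its coset `uH` -/
def IsMinRep (H : Subgroup D.W) (u : D.W) : Prop :=
  ∀ g : D.W, u⁻¹ * g ∈ H → D.length u ≤ D.length g

/-- `a` and `b` lie in the same coset of `H`, i.e. `aH = bH` -/
def SameCoset (H : Subgroup D.W) (a b : D.W) : Prop := a⁻¹ * b ∈ H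

/-- `u →β w` in `W^P`: `β` is a positive root, `u, w` are minimal-length
representatives, `s_β w H = u H`, and `u < w` in Bruhat order -/
def Arrow (H : Subgroup D.W) (u w : D.W) (β : D.V) : Prop :=
  D.IsPosRoot β ∧ D.IsMinRep H u ∧ D.IsMinRep H w ∧
    D.SameCoset H (D.srefl β * w) u ∧ D.bruhatLT u w

/-- `ArrowPath H w [β₁, …, β_r]` encodes a directed path
`x_r →β_r ⋯ → x_1 →β₁ x_0 = w` in the Bruhat graph on `W^P`. -/
def ArrowPath (H : Subgroup D.W) : D.W → List D.V → Prop
  | _, [] => True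
  | w, β :: rest => ∃ u, D.Arrow H u w β ∧ ArrowPath H u rest

/-- directed paths as above whose vertices all lie above `v` in Bruhat order -/
def ArrowPathGE (H : Subgroup D.W) (v : D.W) : D.W → List D.V → Prop
  | _, [] => True
  | w, β :: rest => ∃ u, D.Arrow H u w β ∧ D.bruhatLE v u ∧ ArrowPathGE H v u rest

/-- directed paths from `u` to `w`:
`u = x_r →β_r ⋯ → x_1 →β₁ x_0 = w` encoded by the list `[β₁, …, β_r]`. -/
def ArrowPathFromTo (H : Subgroup D.W) (u : D.W) : D.W → List D.V → Prop
  | w, [] => u = w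
  | w, β :: rest => ∃ x, D.Arrow H x w β ∧ ArrowPathFromTo H u x rest

/-- `S(w) = {β ∈ R⁺ : s_β w < w}` -/
noncomputable def Sset (w : D.W) : Finset D.V :=
  D.roots.filter fun β => D.IsPosRoot β ∧ D.bruhatLT (D.srefl β * w) w

/-- `S(w/v) = {β ∈ R⁺ : v ≤ s_β w < w}` -/
noncomputable def SsetSkew (v w : D.W) : Finset D.V :=
  D.roots.filter fun β =>
    D.IsPosRoot β ∧ D.bruhatLE v (D.srefl β * w) ∧ D.bruhatLT (D.srefl β * w) w

/-- an oriented edge `x → y` in the Bruhat graph of `G/P`: `x, y` are minimal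
representatives, `xH < yH`, and `yH = x s_γ H` for some positive root `γ` -/
def GEdge (H : Subgroup D.W) (x y : D.W) : Prop :=
  D.IsMinRep H x ∧ D.IsMinRep H y ∧ D.bruhatLT x y ∧
    ∃ γ, D.IsPosRoot γ ∧ D.SameCoset H (x * D.srefl γ) y

/-- the (unique) positive root `γ` with `yH = x s_γ H` attached to an edge -/
noncomputable def edgeRoot (H : Subgroup D.W) (x y : D.W) : D.V :=
  if h : ∃ γ, D.IsPosRoot γ ∧ D.SameCoset H (x * D.srefl γ) y then h.choose else 0

/-- `GChainTo H v t [x₁, …, x_r]` encodes a directed path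
`v ≤ x_r → ⋯ → x_1 → x_0 = t` in the Bruhat graph of `G/P` -/
def GChainTo (H : Subgroup D.W) (v : D.W) : D.W → List D.W → Prop
  | _, [] => True
  | t, x :: rest => D.GEdge H x t ∧ D.bruhatLE v x ∧ GChainTo H v x rest

/-- the weighted term
`(m_Λ(x_r,x_{r-1})/W_Λ(x_r)) ⋯ (m_Λ(x_1,x_0)/W_Λ(x_1))` of a path in the
`Λ`-Bruhat graph, computed in a field `F` via a linear embedding `emb`. -/
noncomputable def chainTerm {F : Type} [Field F] [Algebra ℚ F]
    (emb : D.V →ₗ[ℚ] F) (H : Subgroup D.W) (Lam : D.W → D.V) (w : D.W) :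
    D.W → List D.W → F
  | _, [] => 1
  | t, x :: rest =>
      algebraMap ℚ F (D.coroot (D.edgeRoot H x t) (Lam x)) *
        (emb (D.act x (Lam x) - D.act w (Lam x)))⁻¹ *
        chainTerm emb H Lam w x rest

/-- the Bruhat order on cosets: `aH ≤ bH` -/
def cosetLE (H : Subgroup D.W) (a b : D.W) : Prop :=
  ∃ x y, D.SameCoset H a x ∧ D.SameCoset H b y ∧ D.bruhatLE x y

/-- the (standard) parabolic subgroup generated by simple reflections in `J` -/
def parab (J : Set D.I) : Subgroup D.W := Subgroup.closure (D.s '' J)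

/-- `X*(T)_P`: integral weights orthogonal to all coroots of `W_P`,
i.e. to `γ∨` for all positive roots `γ` in the span of the simple roots of `P` -/
def OrthWeightP (J : Set D.I) (lam : D.V) : Prop :=
  D.IsIntegral lam ∧
    ∀ γ, D.IsPosRoot γ → γ ∈ Submodule.span ℚ (D.simple '' J) → D.coroot γ lam = 0

/-- an admissible function `Λ : [v,w]^P → X*(T)_P` -/
def Admissible (J : Set D.I) (v w : D.W) (Lam : D.W → D.V) : Prop :=
  (∀ x, D.IsMinRep (D.parab J) x → D.bruhatLE v x → D.bruhatLE x w →
      D.OrthWeightP J (Lam x)) ∧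
  (∀ x, D.IsMinRep (D.parab J) x → D.bruhatLE v x → D.bruhatLE x w → x ≠ w →
      D.act x (Lam x) ≠ D.act w (Lam x))

/-- the subword of `l` with letters at the positions in `S`, in increasing order -/
def subwordF (l : List D.I) (S : Finset (Fin l.length)) : List D.I :=
  ((List.finRange l.length).filter fun j => j ∈ S).map l.get

/-- `β_j = s_{i_1} ⋯ s_{i_{j-1}}(α_{i_j})` attached to a reduced word `l` -/
noncomputable def refRoot (l : List D.I) (j : Fin l.length) : D.V :=
  D.act (D.wordProd (l.take j.val)) (D.simple (l.get j))

/-- the Weyl group is simply laced: the Cartan pairing is symmetric -/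
def SimplyLaced : Prop :=
  ∀ i j, D.coroot (D.simple i) (D.simple j) = D.coroot (D.simple j) (D.simple i)

/-- generating relation of the heap order of the word `l`:
`p_j < p_k` whenever `j < k` and `s_{i_j}`, `s_{i_k}` do not commute -/
def heapCovers (l : List D.I) (j k : Fin l.length) : Prop :=
  (j : ℕ) < (k : ℕ) ∧ D.s (l.get j) * D.s (l.get k) ≠ D.s (l.get k) * D.s (l.get j)

/-- the heap order of the word `l`: the minimal partial order generated by
`heapCovers` -/
def heapLE (l : List D.I) : Fin l.length → Fin l.length → Prop :=
  Relation.ReflTransGen (D.heapCovers l)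

/-- strict heap order -/
def heapLT (l : List D.I) (j k : Fin l.length) : Prop := D.heapLE l j k ∧ j ≠ k

/-- `F` is an order filter of the heap `H(w)` of the word `l` -/
def IsHeapFilter (l : List D.I) (F : Finset (Fin l.length)) : Prop :=
  ∀ j k, j ∈ F → D.heapLE l j k → k ∈ F

/-- `i` and `j` are joined by an edge of the Dynkin diagram -/
def adjDynkin (i j : D.I) : Prop := i ≠ j ∧ D.s i * D.s j ≠ D.s j * D.s i

/-- an elementary excitation `A ▷ B` of subsets of the heap of the word `l` -/
def Excite (l : List D.I) (A B : Finset (Fin l.length)) : Prop :=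
  ∃ p q, D.heapLT l p q ∧ l.get p = l.get q ∧ q ∈ A ∧ p ∈ B ∧
    A.erase q = B.erase p ∧
    (∀ z, D.heapLT l p z → D.heapLT l z q → l.get z ≠ l.get p) ∧
    ∀ u ∈ A, D.heapLE l p u → D.heapLE l u q → ¬ D.adjDynkin (l.get p) (l.get u)

/-- `A` is an excited diagram of `F` in the heap of the word `l`,
i.e. `A ∈ E_{H(w)}(F)` -/
def InExcited (l : List D.I) (F A : Finset (Fin l.length)) : Prop :=
  Relation.ReflTransGen (D.Excite l) F A

end WeylSetting

namespace WeylSetting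

section Proof

variable {D : WeylSetting}

theorem act_mul' (a b : D.W) (x : D.V) : D.act (a * b) x = D.act a (D.act b x) := by
  rw [map_mul]; rfl

theorem act_one' (x : D.V) : D.act 1 x = x := by
  rw [map_one]; rfl

theorem act_inv_act (a : D.W) (x : D.V) : D.act a⁻¹ (D.act a x) = x := by
  rw [← act_mul', inv_mul_cancel, act_one']

theorem act_act_inv (a : D.W) (x : D.V) : D.act a (D.act a⁻¹ x) = x := by
  rw [← act_mul', mul_inv_cancel, act_one']

theorem act_ext {a b : D.W} (h : ∀ x, D.act a x = D.act b x) : a = b := by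
  have : b⁻¹ * a = 1 := D.act_faithful _ fun x => by
    rw [act_mul', h, act_inv_act]
  exact (inv_mul_eq_one.mp this).symm

theorem root_ne_zero {β : D.V} (hβ : β ∈ D.roots) : β ≠ 0 := by
  rintro rfl
  have := D.coroot_self 0 hβ
  simp at this

theorem act_srefl_self {β : D.V} (hβ : β ∈ D.roots) : D.act (D.srefl β) β = -β := by
  rw [D.srefl_apply β hβ, D.coroot_self β hβ, two_smul]; abel

theorem srefl_sq {β : D.V} (hβ : β ∈ D.roots) : D.srefl β * D.srefl β = 1 := by
  apply act_ext
  intro x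
  rw [act_mul', D.srefl_apply β hβ x, map_sub, map_smul, act_srefl_self hβ, act_one',
    D.srefl_apply β hβ x]
  simp

theorem srefl_inv {β : D.V} (hβ : β ∈ D.roots) : (D.srefl β)⁻¹ = D.srefl β :=
  inv_eq_of_mul_eq_one_left (srefl_sq hβ)

theorem coroot_act {g : D.W} {β : D.V} (hβ : β ∈ D.roots) (x : D.V) :
    D.coroot (D.act g β) x = D.coroot β (D.act g⁻¹ x) := by
  rw [← D.coroot_equivariant g β hβ, act_act_inv]

theorem srefl_conj (g : D.W) {β : D.V} (hβ : β ∈ D.roots) :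
    D.srefl (D.act g β) = g * D.srefl β * g⁻¹ := by
  apply act_ext
  intro x
  rw [D.srefl_apply _ (D.roots_invariant g β hβ), act_mul', act_mul', D.srefl_apply _ hβ,
    map_sub, map_smul, act_act_inv, coroot_act hβ]

/-- the invariant form -/
noncomputable def B (D : WeylSetting) (x y : D.V) : ℚ :=
  ∑ β ∈ D.roots, D.coroot β x * D.coroot β y

theorem B_act (g : D.W) (x y : D.V) : D.B (D.act g x) (D.act g y) = D.B x y := by
  unfold B
  symm
  refine Finset.sum_bij (fun β _ => D.act g β) (fun β hβ => D.roots_invariant g β hβ)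
    (fun a _ b _ h => (D.act g).injective h)
    (fun b hb => ⟨D.act g⁻¹ b, D.roots_invariant _ _ hb, act_act_inv _ _⟩) ?_
  intro β hβ
  rw [D.coroot_equivariant g β hβ, D.coroot_equivariant g β hβ]

theorem B_comm (x y : D.V) : D.B x y = D.B y x := by
  unfold B
  exact Finset.sum_congr rfl fun _ _ => mul_comm _ _

theorem B_add_left (x y z : D.V) : D.B (x + y) z = D.B x z + D.B y z := by
  unfold B
  simp [add_mul, Finset.sum_add_distrib]

theorem B_smul_left (c : ℚ) (x z : D.V) : D.B (c • x) z = c * D.B x z := by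
  unfold B
  simp [Finset.mul_sum, mul_assoc]

theorem B_smul_right (c : ℚ) (x z : D.V) : D.B x (c • z) = c * D.B x z := by
  rw [B_comm, B_smul_left, B_comm]

theorem B_neg_right (x z : D.V) : D.B x (-z) = - D.B x z := by
  have := D.B_smul_right (-1) x z
  simpa using this

theorem B_sum_left (c : D.I → ℚ) (f : D.I → D.V) (z : D.V) :
    D.B (∑ i, c i • f i) z = ∑ i, c i * D.B (f i) z := by
  unfold B
  simp only [map_sum, map_smul, smul_eq_mul, Finset.sum_mul, Finset.mul_sum]
  rw [Finset.sum_comm]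
  simp only [mul_assoc]

theorem B_pos {γ : D.V} (hγ : γ ∈ D.roots) : 0 < D.B γ γ := by
  unfold B
  have h1 : D.coroot γ γ * D.coroot γ γ ≤ ∑ β ∈ D.roots, D.coroot β γ * D.coroot β γ :=
    Finset.single_le_sum (f := fun β => D.coroot β γ * D.coroot β γ)
      (fun β _ => mul_self_nonneg _) hγ
  rw [D.coroot_self γ hγ] at h1
  linarith

theorem two_B {γ : D.V} (hγ : γ ∈ D.roots) (x : D.V) :
    2 * D.B x γ = D.coroot γ x * D.B γ γ := by
  have h1 := D.B_act (D.srefl γ) x γ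
  rw [act_srefl_self hγ, D.srefl_apply γ hγ, B_neg_right] at h1
  have h2 : D.B (x - D.coroot γ x • γ) γ = D.B x γ - D.coroot γ x * D.B γ γ := by
    rw [sub_eq_add_neg, ← neg_smul, B_add_left, B_smul_left]; ring
  rw [h2] at h1
  linarith

theorem exists_co (D : WeylSetting) : ∃ f : D.V →ₗ[ℚ] (D.I → ℚ), ∀ i j,
    f (D.simple i) j = if i = j then 1 else 0 := by
  obtain ⟨g, hg⟩ := LinearMap.exists_extend
    ((Finsupp.lcoeFun : (D.I →₀ ℚ) →ₗ[ℚ] _).comp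
      (D.simple_indep.repr : Submodule.span ℚ (Set.range D.simple) →ₗ[ℚ] (D.I →₀ ℚ)))
  refine ⟨g, fun i j => ?_⟩
  have hm : D.simple i ∈ Submodule.span ℚ (Set.range D.simple) :=
    Submodule.subset_span ⟨i, rfl⟩
  have := LinearMap.congr_fun hg ⟨D.simple i, hm⟩
  simp only [LinearMap.comp_apply, Submodule.subtype_apply] at this
  rw [this]
  have h2 := D.simple_indep.repr_eq_single i ⟨D.simple i, hm⟩ rfl
  simp only [h2, Finsupp.lcoeFun_apply, Finsupp.single_apply]

/-- coordinates w.r.t. the simple roots -/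
noncomputable def co (D : WeylSetting) : D.V →ₗ[ℚ] (D.I → ℚ) := D.exists_co.choose

theorem co_simple (i j : D.I) : D.co (D.simple i) j = if i = j then 1 else 0 :=
  D.exists_co.choose_spec i j

theorem co_sum (c : D.I → ℚ) (j : D.I) : D.co (∑ i, c i • D.simple i) j = c j := by
  simp [map_sum, co_simple, Finset.sum_apply]

/-- the height functional -/
noncomputable def hh (D : WeylSetting) : D.V →ₗ[ℚ] ℚ :=
  (∑ i, LinearMap.proj i : (D.I → ℚ) →ₗ[ℚ] ℚ).comp D.co

theorem hh_apply (x : D.V) : D.hh x = ∑ i, D.co x i := by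
  simp [hh]

theorem hh_simple (i : D.I) : D.hh (D.simple i) = 1 := by
  simp [hh_apply, co_simple]

theorem pos_co {β : D.V} (h : D.IsPosRoot β) (i : D.I) : 0 ≤ D.co β i := by
  obtain ⟨_, c, hc, rfl⟩ := h
  rw [co_sum]; exact hc i

theorem pos_eq {β : D.V} (h : D.IsPosRoot β) : β = ∑ i, D.co β i • D.simple i := by
  obtain ⟨_, c, hc, hβ⟩ := h
  have : ∀ i, D.co β i = c i := fun i => by rw [hβ, co_sum]
  simp only [this]; exact hβ

theorem pos_co_nat {β : D.V} (h : D.IsPosRoot β) (i : D.I) :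
    D.co β i = D.posCoeff β i := by
  have h1 := D.posCoeff_spec β h.1 h.2
  conv_lhs => rw [h1]
  rw [co_sum]

theorem ht_eq {β : D.V} (h : D.IsPosRoot β) : (D.ht β : ℚ) = D.hh β := by
  rw [hh_apply, ht]
  push_cast
  exact Finset.sum_congr rfl fun i _ => (pos_co_nat h i).symm

theorem hh_pos {β : D.V} (h : D.IsPosRoot β) : 0 < D.hh β := by
  have h0 : 0 ≤ D.hh β := by
    rw [hh_apply]; exact Finset.sum_nonneg fun i _ => pos_co h i
  rcases h0.lt_or_eq with h1 | h1
  · exact h1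
  · exfalso
    rw [hh_apply] at h1
    have h2 := (Finset.sum_eq_zero_iff_of_nonneg (fun i _ => pos_co h i)).mp h1.symm
    apply root_ne_zero h.1
    rw [pos_eq h]
    exact Finset.sum_eq_zero fun i hi => by rw [h2 i hi, zero_smul]

theorem pos_or_neg {β : D.V} (h : β ∈ D.roots) : D.IsPosRoot β ∨ D.IsPosRoot (-β) := by
  rcases D.root_pos_or_neg β h with h1 | h1
  · exact Or.inl ⟨h, h1⟩
  · exact Or.inr ⟨D.roots_neg β h, h1⟩

theorem not_pos_iff {β : D.V} (h : β ∈ D.roots) : ¬ D.IsPosRoot β ↔ D.IsPosRoot (-β) := by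
  constructor
  · intro h1; exact (pos_or_neg h).resolve_left h1
  · intro h1 h2
    have := hh_pos h1
    have := hh_pos h2
    simp only [map_neg] at *
    linarith

theorem neg_pos_iff {β : D.V} (h : β ∈ D.roots) : ¬ D.IsPosRoot (-β) ↔ D.IsPosRoot β := by
  rw [not_pos_iff (D.roots_neg β h), neg_neg]

theorem simple_pos (i : D.I) : D.IsPosRoot (D.simple i) :=
  ⟨D.simple_mem i, fun j => if j = i then 1 else 0, fun j => by dsimp only; split_ifs <;> norm_num,
    by simp⟩

theorem hh_int {β : D.V} (h : β ∈ D.roots) : ∃ n : ℤ, D.hh β = n := by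
  rcases pos_or_neg h with h1 | h1
  · exact ⟨D.ht β, by rw [← ht_eq h1]; simp⟩
  · refine ⟨-D.ht (-β), ?_⟩
    have := ht_eq h1
    simp only [map_neg] at this
    push_cast
    linarith

/-- real roots -/
def IsReal (D : WeylSetting) (β : D.V) : Prop := ∃ (g : D.W) (i : D.I), β = D.act g (D.simple i)

theorem IsReal.mem {β : D.V} (h : D.IsReal β) : β ∈ D.roots := by
  obtain ⟨g, i, rfl⟩ := h
  exact D.roots_invariant g _ (D.simple_mem i)

theorem IsReal.act {β : D.V} (h : D.IsReal β) (g : D.W) : D.IsReal (D.act g β) := by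
  obtain ⟨g', i, rfl⟩ := h
  exact ⟨g * g', i, by rw [act_mul']⟩

theorem real_simple (i : D.I) : D.IsReal (D.simple i) := ⟨1, i, by rw [act_one']⟩

theorem IsReal.neg {β : D.V} (h : D.IsReal β) : D.IsReal (-β) := by
  obtain ⟨g, i, rfl⟩ := h
  refine ⟨g * D.s i, i, ?_⟩
  rw [act_mul', s, act_srefl_self (D.simple_mem i), map_neg]

theorem s_apply (i : D.I) (x : D.V) :
    D.act (D.s i) x = x - D.coroot (D.simple i) x • D.simple i :=
  D.srefl_apply _ (D.simple_mem i) x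

theorem s_simple (i : D.I) : D.act (D.s i) (D.simple i) = - D.simple i :=
  act_srefl_self (D.simple_mem i)

theorem s_sq (i : D.I) : D.s i * D.s i = 1 := srefl_sq (D.simple_mem i)

theorem s_inv (i : D.I) : (D.s i)⁻¹ = D.s i := srefl_inv (D.simple_mem i)

theorem s_s_act (i : D.I) (x : D.V) : D.act (D.s i) (D.act (D.s i) x) = x := by
  rw [← act_mul', s_sq, act_one']

theorem s_mul_s_mul (i : D.I) (g : D.W) : D.s i * (D.s i * g) = g := by
  rw [← mul_assoc, s_sq, one_mul]

/-- a positive root made negative by `s_i` is a multiple of `α_i` -/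
theorem prop_of_neg {β : D.V} (h : D.IsPosRoot β) {i : D.I}
    (hn : ¬ D.IsPosRoot (D.act (D.s i) β)) : β = D.co β i • D.simple i := by
  have hn' := (not_pos_iff (D.roots_invariant _ _ h.1)).mp hn
  conv_lhs => rw [pos_eq h]
  refine Finset.sum_eq_single i (fun j _ hj => ?_) (by simp)
  have h1 := pos_co hn' j
  have h2 := pos_co h j
  rw [s_apply] at h1
  simp only [neg_sub, map_sub, map_smul, Pi.sub_apply, Pi.smul_apply, co_simple,
    if_neg (Ne.symm hj), smul_zero, zero_sub] at h1
  have : D.co β j = 0 := by linarith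
  rw [this, zero_smul]

theorem eq_simple_of_neg {β : D.V} (h : D.IsPosRoot β) (hr : D.IsReal β) {i : D.I}
    (hn : ¬ D.IsPosRoot (D.act (D.s i) β)) : β = D.simple i := by
  have h1 := prop_of_neg h hn
  rw [pos_co_nat h] at h1
  obtain ⟨g, k, hg⟩ := hr
  have h2 : D.simple k = (D.posCoeff β i : ℚ) • D.act g⁻¹ (D.simple i) := by
    rw [← map_smul, ← h1, hg, act_inv_act]
  have h3 := congrArg D.hh h2
  obtain ⟨n, hn⟩ := hh_int (D.roots_invariant g⁻¹ _ (D.simple_mem i))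
  rw [hh_simple, map_smul, hn, smul_eq_mul] at h3
  have h4 : (1 : ℤ) = (D.posCoeff β i : ℤ) * n := by exact_mod_cast h3
  have h5 : (D.posCoeff β i : ℤ) = 1 :=
    Int.eq_one_of_mul_eq_one_right (by positivity) h4.symm
  have h6 : D.posCoeff β i = 1 := by exact_mod_cast h5
  rw [h6] at h1
  simpa using h1

theorem s_pos {β : D.V} (h : D.IsPosRoot β) (hr : D.IsReal β) {i : D.I}
    (hn : β ≠ D.simple i) : D.IsPosRoot (D.act (D.s i) β) := by
  by_contra hc
  exact hn (eq_simple_of_neg h hr hc)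

theorem srefl_of_prop {β : D.V} (h : β ∈ D.roots) {i : D.I} {c : ℚ}
    (hc : β = c • D.simple i) : D.srefl β = D.s i := by
  have hc0 : c ≠ 0 := by
    rintro rfl
    exact root_ne_zero h (by simpa using hc)
  apply act_ext
  intro x
  rw [D.srefl_apply β h, s_apply]
  have h1 := two_B h x
  have h2 := two_B (D.simple_mem i) x
  have h3 := B_pos (D.simple_mem i)
  have h4 : D.coroot β x * c = D.coroot (D.simple i) x := by
    have e1 : D.B x β = c * D.B x (D.simple i) := by rw [hc, B_smul_right]
    have e2 : D.B β β = c * c * D.B (D.simple i) (D.simple i) := by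
      rw [hc, B_smul_right, B_smul_left]; ring
    rw [e1, e2] at h1
    have : c * D.B (D.simple i) (D.simple i) *
      (D.coroot β x * c - D.coroot (D.simple i) x) = 0 := by linear_combination c * h2 - h1
    rcases mul_eq_zero.mp this with h5 | h5
    · exact absurd h5 (mul_ne_zero hc0 h3.ne')
    · linarith
  rw [← h4, mul_smul, ← hc]

theorem coroot_pos_eq {γ : D.V} (h : D.IsPosRoot γ) (x : D.V) :
    D.coroot γ x * D.B γ γ =
      ∑ i, D.co γ i * (D.coroot (D.simple i) x * D.B (D.simple i) (D.simple i)) := by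
  rw [← two_B h.1, B_comm]
  conv_lhs => rw [pos_eq h]
  rw [B_sum_left, Finset.mul_sum]
  refine Finset.sum_congr rfl fun i _ => ?_
  rw [← two_B (D.simple_mem i), B_comm]; ring

theorem dom_nonneg {pi : D.V} (hpi : D.IsDominant pi) {γ : D.V} (h : D.IsPosRoot γ) :
    0 ≤ D.coroot γ pi := by
  have h1 := coroot_pos_eq h pi
  have h2 := B_pos h.1
  have h3 : 0 ≤ D.coroot γ pi * D.B γ γ := by
    rw [h1]
    exact Finset.sum_nonneg fun i _ => mul_nonneg (pos_co h i)
      (mul_nonneg (hpi.2 i) (B_pos (D.simple_mem i)).le)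
  exact nonneg_of_mul_nonneg_left h3 h2

theorem cartan_nonpos {i j : D.I} (h : i ≠ j) : D.coroot (D.simple i) (D.simple j) ≤ 0 := by
  have h1 : D.IsPosRoot (D.act (D.s i) (D.simple j)) := by
    apply s_pos (simple_pos j) (real_simple j)
    intro hc
    exact h (D.simple_indep.injective hc).symm
  have h2 := pos_co h1 i
  rw [s_apply] at h2
  simp only [map_sub, map_smul, Pi.sub_apply, Pi.smul_apply, co_simple, if_neg (Ne.symm h),
    if_true, smul_eq_mul, mul_one] at h2
  linarith

theorem cartan_zero {i j : D.I} (h : D.coroot (D.simple i) (D.simple j) = 0) :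
    D.coroot (D.simple j) (D.simple i) = 0 := by
  have h1 := two_B (D.simple_mem i) (D.simple j)
  have h2 := two_B (D.simple_mem j) (D.simple i)
  rw [h, B_comm] at h1
  have : D.coroot (D.simple j) (D.simple i) * D.B (D.simple j) (D.simple j) = 0 := by
    linarith
  exact (mul_eq_zero.mp this).resolve_right (B_pos (D.simple_mem j)).ne'

theorem s_comm {i j : D.I} (h : D.coroot (D.simple i) (D.simple j) = 0) :
    D.s i * D.s j = D.s j * D.s i := by
  apply act_ext
  intro x
  simp only [act_mul', s_apply, map_sub, map_smul, h, cartan_zero h, zero_smul,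
    sub_zero]
  abel


theorem wordProd_nil : D.wordProd [] = 1 := by simp [wordProd]

theorem wordProd_cons (i : D.I) (l : List D.I) :
    D.wordProd (i :: l) = D.s i * D.wordProd l := by simp [wordProd]

theorem wordProd_append (l m : List D.I) :
    D.wordProd (l ++ m) = D.wordProd l * D.wordProd m := by simp [wordProd]

theorem wordProd_reverse (l : List D.I) : D.wordProd l.reverse = (D.wordProd l)⁻¹ := by
  induction l with
  | nil => simp [wordProd]
  | cons i l ih =>
    rw [List.reverse_cons, wordProd_append, ih, wordProd_cons, wordProd_cons, wordProd_nil,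
      mul_one, mul_inv_rev, s_inv]

theorem length_le (l : List D.I) : D.length (D.wordProd l) ≤ l.length :=
  Nat.sInf_le ⟨l, rfl, rfl⟩

theorem exists_reduced (g : D.W) : ∃ l, D.wordProd l = g ∧ l.length = D.length g := by
  have hne : {n | ∃ l : List D.I, l.length = n ∧ D.wordProd l = g}.Nonempty := by
    obtain ⟨l, hl⟩ := D.generated g
    exact ⟨l.length, l, rfl, hl.symm⟩
  obtain ⟨l, h1, h2⟩ := Nat.sInf_mem hne
  exact ⟨l, h2, h1⟩

theorem length_one : D.length (1 : D.W) = 0 := by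
  have := D.length_le []
  rw [wordProd_nil] at this
  simpa using this

theorem eq_one_of_length {g : D.W} (h : D.length g = 0) : g = 1 := by
  obtain ⟨l, h1, h2⟩ := exists_reduced g
  rw [h, List.length_eq_zero_iff] at h2
  rw [← h1, h2, wordProd_nil]

theorem length_mul_le (a b : D.W) : D.length (a * b) ≤ D.length a + D.length b := by
  obtain ⟨l, h1, h2⟩ := exists_reduced a
  obtain ⟨m, h3, h4⟩ := exists_reduced b
  have := D.length_le (l ++ m)
  rwa [wordProd_append, h1, h3, List.length_append, h2, h4] at this

theorem length_inv_le (a : D.W) : D.length a⁻¹ ≤ D.length a := by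
  obtain ⟨l, h1, h2⟩ := exists_reduced a
  have := D.length_le l.reverse
  rwa [wordProd_reverse, h1, List.length_reverse, h2] at this

theorem length_inv (a : D.W) : D.length a⁻¹ = D.length a := by
  apply le_antisymm (length_inv_le a)
  simpa using length_inv_le a⁻¹

theorem length_s_le (i : D.I) : D.length (D.s i) ≤ 1 := by
  have := D.length_le [i]
  rwa [wordProd_cons, wordProd_nil, mul_one] at this

theorem length_s_mul_le (i : D.I) (g : D.W) : D.length (D.s i * g) ≤ D.length g + 1 := by
  have := length_mul_le (D.s i) g
  have := D.length_s_le i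
  omega

theorem length_le_s_mul (i : D.I) (g : D.W) : D.length g ≤ D.length (D.s i * g) + 1 := by
  have := length_s_mul_le i (D.s i * g)
  rwa [s_mul_s_mul] at this

theorem srefl_neg {β : D.V} (h : β ∈ D.roots) : D.srefl (-β) = D.srefl β := by
  rw [← act_srefl_self h, srefl_conj _ h, mul_inv_cancel_right]

/-- strong exchange -/
theorem exchange (l : List D.I) : ∀ {β : D.V}, D.IsPosRoot β →
    ¬ D.IsPosRoot (D.act (D.wordProd l)⁻¹ β) →
    ∃ l', List.Sublist l' l ∧ l'.length + 1 = l.length ∧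
      D.wordProd l' = D.srefl β * D.wordProd l := by
  induction l with
  | nil =>
    intro β hβ hn
    rw [wordProd_nil, inv_one, act_one'] at hn
    exact absurd hβ hn
  | cons i l ih =>
    intro β hβ hn
    by_cases hs : D.IsPosRoot (D.act (D.s i) β)
    · rw [wordProd_cons, mul_inv_rev, act_mul', s_inv] at hn
      obtain ⟨l', h1, h2, h3⟩ := ih hs hn
      refine ⟨i :: l', h1.cons_cons i, by simp [h2], ?_⟩
      rw [wordProd_cons, wordProd_cons, h3, srefl_conj _ hβ.1, s_inv]
      simp only [mul_assoc]
      rw [s_mul_s_mul]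
    · refine ⟨l, List.sublist_cons_self i l, by simp, ?_⟩
      rw [srefl_of_prop hβ.1 (prop_of_neg hβ hs), wordProd_cons, s_mul_s_mul]

theorem length_srefl_lt {β : D.V} {g : D.W} (hβ : D.IsPosRoot β)
    (hn : ¬ D.IsPosRoot (D.act g⁻¹ β)) : D.length (D.srefl β * g) < D.length g := by
  obtain ⟨l, h1, h2⟩ := exists_reduced g
  rw [← h1] at hn
  obtain ⟨l', h3, h4, h5⟩ := exchange l hβ hn
  have := D.length_le l'
  rw [h5, h1] at this
  omega

theorem length_lt_srefl {β : D.V} {g : D.W} (hβ : D.IsPosRoot β)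
    (hn : D.IsPosRoot (D.act g⁻¹ β)) : D.length g < D.length (D.srefl β * g) := by
  have := length_srefl_lt (g := D.srefl β * g) hβ (by
    rw [mul_inv_rev, srefl_inv hβ.1, act_mul', act_srefl_self hβ.1, map_neg,
      not_pos_iff (D.roots_neg _ hn.1), neg_neg]
    exact hn)
  rwa [← mul_assoc, srefl_sq hβ.1, one_mul] at this

theorem length_s_up {i : D.I} {g : D.W} (h : D.IsPosRoot (D.act g⁻¹ (D.simple i))) :
    D.length (D.s i * g) = D.length g + 1 := by
  have h1 : D.length g < D.length (D.s i * g) := length_lt_srefl (simple_pos i) h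
  have := length_s_mul_le i g
  omega

theorem length_s_down {i : D.I} {g : D.W} (h : ¬ D.IsPosRoot (D.act g⁻¹ (D.simple i))) :
    D.length (D.s i * g) + 1 = D.length g := by
  have h1 : D.length (D.s i * g) < D.length g := length_srefl_lt (simple_pos i) h
  have := length_le_s_mul i g
  omega

theorem s_up_iff {i : D.I} {g : D.W} :
    D.IsPosRoot (D.act g⁻¹ (D.simple i)) ↔ D.length (D.s i * g) = D.length g + 1 := by
  constructor
  · exact length_s_up
  · intro h
    by_contra hc
    have := length_s_down hc
    omega

theorem act_s_mul_inv (i : D.I) (g : D.W) :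
    D.act (D.s i * g)⁻¹ (D.simple i) = - D.act g⁻¹ (D.simple i) := by
  rw [mul_inv_rev, act_mul', s_inv, s_simple, map_neg]

theorem mul_srefl (v : D.W) {γ : D.V} (h : γ ∈ D.roots) :
    v * D.srefl γ = D.srefl (D.act v γ) * v := by
  rw [srefl_conj v h, inv_mul_cancel_right]

theorem pos_of_length_lt {v : D.W} {γ : D.V} (h : D.IsPosRoot γ)
    (hl : D.length v < D.length (v * D.srefl γ)) : D.IsPosRoot (D.act v γ) := by
  have hm := D.roots_invariant v γ h.1
  by_contra hc
  have hc' := (not_pos_iff hm).mp hc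
  have := length_srefl_lt (g := v) hc' (by
    rw [map_neg, act_inv_act, not_pos_iff (D.roots_neg _ h.1), neg_neg]; exact h)
  rw [srefl_neg hm, ← mul_srefl v h.1] at this
  omega

/-- lifting property -/
theorem lifting {v : D.W} {γ : D.V} {i : D.I} (h : D.IsPosRoot γ) (hr : D.IsReal γ)
    (hl : D.length (v * D.srefl γ) = D.length v + 1)
    (hv : D.IsPosRoot (D.act v⁻¹ (D.simple i)))
    (hu : ¬ D.IsPosRoot (D.act (v * D.srefl γ)⁻¹ (D.simple i))) :
    γ = D.act v⁻¹ (D.simple i) := by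
  have hp := pos_of_length_lt h (v := v) (by omega)
  by_contra hne
  have hne' : D.act v γ ≠ D.simple i := by
    intro h'
    rw [← h', act_inv_act] at hne
    exact hne rfl
  have hs := s_pos hp (hr.act v) hne'
  have h1 := length_s_down hu
  have h2 := length_s_up hv
  have h3 := length_lt_srefl (g := D.s i * v) hs (by
    rw [mul_inv_rev, act_mul', s_inv, s_s_act, act_inv_act]; exact h)
  have h4 : D.srefl (D.act (D.s i) (D.act v γ)) * (D.s i * v) = D.s i * (v * D.srefl γ) := by
    rw [srefl_conj _ hp.1, mul_srefl v h.1]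
    group
  rw [h4] at h3
  omega

/-- `m` applied to `v` is length additive -/
def Up (D : WeylSetting) (v : D.W) (m : List D.I) : Prop :=
  D.length (D.wordProd m * v) = m.length + D.length v

theorem up_nil (v : D.W) : D.Up v [] := by simp [Up, wordProd_nil]

theorem up_cons {v : D.W} {j : D.I} {m : List D.I} :
    D.Up v (j :: m) ↔ D.Up v m ∧ D.IsPosRoot (D.act (D.wordProd m * v)⁻¹ (D.simple j)) := by
  rw [s_up_iff]
  unfold Up
  rw [wordProd_cons, mul_assoc, List.length_cons]
  have h1 := length_s_mul_le j (D.wordProd m * v)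
  have h2 := length_mul_le (D.wordProd m) v
  have h3 := D.length_le m
  omega

theorem up_one {l : List D.I} : D.Up 1 l ↔ l.length = D.length (D.wordProd l) := by
  unfold Up
  rw [mul_one, length_one, add_zero]
  exact eq_comm

theorem inv_mono {v : D.W} {γ : D.V} (hr : D.IsReal γ)
    (hγ : D.IsPosRoot γ) (hn : ¬ D.IsPosRoot (D.act v γ)) :
    ∀ {m : List D.I}, D.Up v m → ¬ D.IsPosRoot (D.act (D.wordProd m * v) γ) := by
  intro m
  induction m with
  | nil => intro _; rwa [wordProd_nil, one_mul]
  | cons j m ih =>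
    intro hup hp
    obtain ⟨h1, h2⟩ := up_cons.mp hup
    have h3 := ih h1
    rw [wordProd_cons, mul_assoc, act_mul'] at hp
    have hre := hr.act (D.wordProd m * v)
    rw [not_pos_iff hre.mem] at h3
    have h4 : - D.act (D.wordProd m * v) γ = D.simple j := by
      apply eq_simple_of_neg h3 hre.neg
      rw [map_neg, not_pos_iff (D.roots_neg _ hp.1), neg_neg]
      exact hp
    rw [← h4, map_neg, act_inv_act] at h2
    exact (not_pos_iff (D.roots_neg _ hγ.1)).mpr (by rwa [neg_neg]) h2


/-- all inversions pair to one with `pi` -/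
def MinInv (D : WeylSetting) (pi : D.V) (w : D.W) : Prop :=
  ∀ γ, D.IsReal γ → D.IsPosRoot γ → ¬ D.IsPosRoot (D.act w γ) → D.coroot γ pi = 1

/-- no simple inversion is orthogonal to `pi` -/
def InWP (D : WeylSetting) (pi : D.V) (v : D.W) : Prop :=
  ∀ i, ¬ D.IsPosRoot (D.act v (D.simple i)) → D.coroot (D.simple i) pi ≠ 0

theorem inWP_of_minrep {pi : D.V} {v : D.W} (h : D.IsMinRep (D.stab pi) v) : D.InWP pi v := by
  intro i hi h0
  have h1 : D.act (D.s i) pi = pi := by rw [s_apply, h0]; simp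
  have h2 := h (v * D.s i) (by rw [inv_mul_cancel_left]; exact h1)
  have h3 := length_s_down (i := i) (g := v⁻¹) (by rwa [inv_inv])
  rw [length_inv, ← length_inv, mul_inv_rev, inv_inv, s_inv] at h3
  omega

theorem inWP_strong {pi : D.V} (hpi : D.IsDominant pi) {v : D.W} (h : D.InWP pi v) {γ : D.V}
    (hγ : D.IsPosRoot γ) (hn : ¬ D.IsPosRoot (D.act v γ)) : D.coroot γ pi ≠ 0 := by
  intro h0
  have h1 := coroot_pos_eq hγ pi
  rw [h0, zero_mul] at h1
  have h2 := (Finset.sum_eq_zero_iff_of_nonneg (fun i _ => mul_nonneg (pos_co hγ i)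
      (mul_nonneg (hpi.2 i) (B_pos (D.simple_mem i)).le))).mp h1.symm
  rw [not_pos_iff (D.roots_invariant _ _ hγ.1)] at hn
  have h3 := hh_pos hn
  have h4 : D.hh (D.act v γ) = ∑ i, D.co γ i * D.hh (D.act v (D.simple i)) := by
    conv_lhs => rw [pos_eq hγ]
    simp [map_sum]
  have h5 : 0 ≤ D.hh (D.act v γ) := by
    rw [h4]
    refine Finset.sum_nonneg fun i hi => ?_
    by_cases hp : D.IsPosRoot (D.act v (D.simple i))
    · exact mul_nonneg (pos_co hγ i) (hh_pos hp).le
    · have h6 := h i hp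
      have h7 := (mul_eq_zero.mp (h2 i hi)).resolve_right
        (mul_ne_zero h6 (B_pos (D.simple_mem i)).ne')
      rw [h7, zero_mul]
  rw [map_neg] at h3
  linarith

theorem up_single {v : D.W} {i : D.I} (h : D.IsPosRoot (D.act v⁻¹ (D.simple i))) :
    D.Up v [i] := by
  rw [up_cons, wordProd_nil, one_mul]
  exact ⟨up_nil v, h⟩

theorem wordProd_single (i : D.I) : D.wordProd [i] = D.s i := by
  rw [wordProd_cons, wordProd_nil, mul_one]

theorem inWP_down {pi : D.V} {v : D.W} {i : D.I} (h : D.InWP pi (D.s i * v))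
    (hv : D.IsPosRoot (D.act v⁻¹ (D.simple i))) : D.InWP pi v := by
  intro j hj
  apply h j
  have := inv_mono (real_simple j) (simple_pos j) hj (up_single hv)
  rwa [wordProd_single] at this

theorem minInv_of_up {pi : D.V} {v : D.W} {m : List D.I} (hm : D.Up v m)
    (h : D.MinInv pi (D.wordProd m * v)) : D.MinInv pi v := by
  intro γ hr hp hn
  exact h γ hr hp (inv_mono hr hp hn hm)

theorem inWP_of_minInv {pi : D.V} {v : D.W} (h : D.MinInv pi v) : D.InWP pi v := by
  intro i hi
  rw [h _ (real_simple i) (simple_pos i) hi]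
  norm_num

theorem minInv_step {pi : D.V} {u : D.W} {j : D.I}
    (hu : D.IsPosRoot (D.act u⁻¹ (D.simple j))) (h : D.MinInv pi (D.s j * u)) :
    D.MinInv pi u ∧ D.coroot (D.simple j) (D.act u pi) = 1 := by
  constructor
  · apply minInv_of_up (up_single hu)
    rwa [wordProd_single]
  · have := h _ ((real_simple j).act u⁻¹) hu (by
      rw [act_mul', act_act_inv, s_simple, not_pos_iff (D.roots_neg _ (D.simple_mem j)), neg_neg]
      exact simple_pos j)
    rwa [coroot_act (D.simple_mem j), inv_inv] at this

theorem hh_chain {pi : D.V} {v : D.W} : ∀ {m : List D.I}, D.Up v m →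
    D.MinInv pi (D.wordProd m * v) →
    D.hh (D.act v pi - D.act (D.wordProd m * v) pi) = m.length := by
  intro m
  induction m with
  | nil => intro _ _; simp [wordProd_nil]
  | cons j m ih =>
    intro hup hmin
    obtain ⟨h1, h2⟩ := up_cons.mp hup
    rw [wordProd_cons, mul_assoc] at hmin ⊢
    obtain ⟨h3, h4⟩ := minInv_step h2 hmin
    have h5 := ih h1 h3
    rw [act_mul' (D.s j), s_apply, h4]
    simp only [map_sub, map_smul, hh_simple, List.length_cons] at *
    push_cast
    simp only [smul_eq_mul, mul_one]
    linarith

theorem minInv_of_word {pi : D.V} : ∀ {l : List D.I}, D.Up 1 l →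
    (∀ k : Fin l.length,
      D.coroot (D.simple (l.get k)) (D.act (D.wordProd (l.drop (k.val + 1))) pi) = 1) →
    D.MinInv pi (D.wordProd l) := by
  intro l
  induction l with
  | nil =>
    intro _ _ γ _ hp hn
    rw [wordProd_nil, act_one'] at hn
    exact absurd hp hn
  | cons i l ih =>
    intro hup hk γ hr hp hn
    obtain ⟨h1, h2⟩ := up_cons.mp hup
    rw [mul_one] at h2
    have h3 := ih h1 (fun k => by simpa using hk k.succ)
    have h4 : D.coroot (D.simple i) (D.act (D.wordProd l) pi) = 1 := by
      simpa using hk ⟨0, by simp⟩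
    by_cases hq : D.IsPosRoot (D.act (D.wordProd l) γ)
    · rw [wordProd_cons, act_mul'] at hn
      have h5 := eq_simple_of_neg hq (hr.act _) hn
      rw [← h5, D.coroot_equivariant _ _ hp.1] at h4
      exact h4
    · exact h3 γ hr hp hq

theorem minInv_of_minuscule {pi : D.V} {w : D.W} (h : D.IsMinuscule pi w) :
    D.MinInv pi w := by
  obtain ⟨l, ⟨h1, h2⟩, h3⟩ := h
  rw [← h1]
  exact minInv_of_word (up_one.mpr (by rw [h1, h2])) h3

theorem lemmaC {pi : D.V} {v : D.W} {i : D.I}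
    (hc : 1 ≤ D.coroot (D.simple i) (D.act v pi)) : ∀ {m : List D.I}, D.Up v m →
    D.MinInv pi (D.wordProd m * v) →
    (1 ≤ D.coroot (D.simple i) (D.act (D.wordProd m * v) pi) ∧
      (D.coroot (D.simple i) (D.act (D.wordProd m * v) pi) = 1 →
        D.s i * D.wordProd m = D.wordProd m * D.s i ∧
        D.Up (D.s i * v) m)) ∨
    ∃ m2, D.Up (D.s i * v) m2 ∧ D.wordProd m2 * (D.s i * v) = D.wordProd m * v := by
  intro m
  induction m with
  | nil =>
    intro _ _
    left
    rw [wordProd_nil, one_mul]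
    exact ⟨hc, fun _ => ⟨by simp, up_nil _⟩⟩
  | cons j m ih =>
    intro hup hmin
    obtain ⟨h1, h2⟩ := up_cons.mp hup
    rw [wordProd_cons, mul_assoc] at hmin
    obtain ⟨h3, h4⟩ := minInv_step h2 hmin
    have hjm : D.wordProd (j :: m) * v = D.s j * (D.wordProd m * v) := by
      rw [wordProd_cons, mul_assoc]
    rcases ih h1 h3 with ⟨ha, hb⟩ | ⟨m2, ha, hb⟩
    · by_cases hji : j = i
      · subst hji
        obtain ⟨hb1, hb2⟩ := hb h4
        right
        refine ⟨m, hb2, ?_⟩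
        rw [hjm, ← mul_assoc, ← hb1, mul_assoc]
      · left
        have hneg := cartan_nonpos (Ne.symm hji)
        have he : D.coroot (D.simple i) (D.act (D.wordProd (j :: m) * v) pi) =
            D.coroot (D.simple i) (D.act (D.wordProd m * v) pi) -
              D.coroot (D.simple i) (D.simple j) := by
          rw [hjm, act_mul' (D.s j), s_apply, h4, one_smul, map_sub]
        rw [he]
        refine ⟨by linarith, fun h5 => ?_⟩
        have h6 : D.coroot (D.simple i) (D.simple j) = 0 := by linarith
        obtain ⟨hb1, hb2⟩ := hb (by linarith)
        refine ⟨?_, up_cons.mpr ⟨hb2, ?_⟩⟩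
        · rw [wordProd_cons, ← mul_assoc, s_comm h6, mul_assoc, hb1, mul_assoc]
        · have h7 : D.wordProd m * (D.s i * v) = D.s i * (D.wordProd m * v) := by
            rw [← mul_assoc, ← hb1, mul_assoc]
          rw [h7, mul_inv_rev, act_mul', s_inv, s_apply, h6, zero_smul, sub_zero]
          exact h2
    · right
      refine ⟨j :: m2, up_cons.mpr ⟨ha, by rwa [hb]⟩, ?_⟩
      rw [wordProd_cons, mul_assoc, hb, hjm]

theorem lemmaB {pi : D.V} (hpi : D.IsDominant pi) : ∀ {l l' : List D.I}, D.Up 1 l →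
    D.MinInv pi (D.wordProd l) → List.Sublist l' l → D.InWP pi (D.wordProd l') →
    ∃ m, D.Up (D.wordProd l') m ∧ D.wordProd m * D.wordProd l' = D.wordProd l := by
  intro l
  induction l with
  | nil =>
    intro l' _ _ hs _
    rw [List.sublist_nil] at hs
    subst hs
    exact ⟨[], up_nil _, by simp [wordProd_nil]⟩
  | cons i l ih =>
    intro l' hup hmin hs hv
    obtain ⟨h1, h2⟩ := up_cons.mp hup
    rw [mul_one] at h2
    rw [wordProd_cons] at hmin
    obtain ⟨h3, h4⟩ := minInv_step h2 hmin
    have key : ∀ l'' : List D.I, List.Sublist l'' l → D.InWP pi (D.wordProd l'') →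
        ∃ m, D.Up (D.wordProd l'') m ∧
          D.wordProd m * D.wordProd l'' = D.wordProd (i :: l) := by
      intro l'' hs' hv'
      obtain ⟨m, h5, h6⟩ := ih h1 h3 hs' hv'
      refine ⟨i :: m, up_cons.mpr ⟨h5, by rwa [h6]⟩, ?_⟩
      rw [wordProd_cons, wordProd_cons, mul_assoc, h6]
    rcases List.sublist_cons_iff.mp hs with hs' | ⟨r, rfl, hs'⟩
    · exact key l' hs' hv
    · by_cases hp : D.IsPosRoot (D.act (D.wordProd r)⁻¹ (D.simple i))
      · rw [wordProd_cons] at hv ⊢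
        obtain ⟨m, h5, h6⟩ := ih h1 h3 hs' (inWP_down hv hp)
        have hc : 1 ≤ D.coroot (D.simple i) (D.act (D.wordProd r) pi) := by
          have e1 : D.coroot (D.simple i) (D.act (D.wordProd r) pi) =
              D.coroot (D.act (D.wordProd r)⁻¹ (D.simple i)) pi := by
            rw [coroot_act (D.simple_mem i), inv_inv]
          have e2 : D.coroot (D.act (D.wordProd r)⁻¹ (D.simple i)) pi ≠ 0 := by
            apply inWP_strong hpi hv hp
            rw [act_mul', act_act_inv, s_simple,
              not_pos_iff (D.roots_neg _ (D.simple_mem i)), neg_neg]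
            exact simple_pos i
          have e3 := dom_nonneg hpi hp
          obtain ⟨n, hn⟩ := hpi.1 _ hp
          rw [e1]
          rw [hn] at e2 e3 ⊢
          have e4 : (0 : ℤ) ≤ n := by exact_mod_cast e3
          have e5 : n ≠ 0 := by exact_mod_cast e2
          have e6 : (1 : ℤ) ≤ n := by omega
          exact_mod_cast e6
        rcases lemmaC hc h5 (by rwa [h6]) with ⟨ha, hb⟩ | ⟨m2, ha, hb⟩
        · rw [h6] at hb
          obtain ⟨hb1, hb2⟩ := hb h4
          refine ⟨m, hb2, ?_⟩
          rw [← mul_assoc, ← hb1, mul_assoc, h6, wordProd_cons]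
        · refine ⟨i :: m2, up_cons.mpr ⟨ha, by rwa [hb, h6]⟩, ?_⟩
          rw [wordProd_cons, wordProd_cons, mul_assoc, hb, h6]
      · obtain ⟨r', h5, _, h6⟩ := exchange r (simple_pos i) hp
        have h7 : D.wordProd (i :: r) = D.wordProd r' := by rw [h6, wordProd_cons]; rfl
        rw [h7] at hv ⊢
        exact key r' (h5.trans hs') hv

theorem bruhat_sublist {v w : D.W} (h : D.bruhatLE v w) : ∀ l : List D.I, D.wordProd l = w →
    ∃ l', List.Sublist l' l ∧ D.wordProd l' = v := by
  unfold bruhatLE at h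
  induction h with
  | refl => intro l hl; exact ⟨l, List.Sublist.refl l, hl⟩
  | @tail a b hva hab ih =>
    intro l hl
    obtain ⟨⟨β, hβ, rfl⟩, hlt⟩ := hab
    have hn : ¬ D.IsPosRoot (D.act (D.wordProd l)⁻¹ β) := by
      intro hp
      rw [hl] at hp
      have := length_lt_srefl hβ hp
      rw [← mul_assoc, srefl_sq hβ.1, one_mul] at this
      omega
    obtain ⟨l1, h1, _, h2⟩ := exchange l hβ hn
    rw [hl, ← mul_assoc, srefl_sq hβ.1, one_mul] at h2
    obtain ⟨l2, h3, h4⟩ := ih l1 h2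
    exact ⟨l2, h3.trans h1, h4⟩

/-- localisation of Schubert classes, recursively -/
noncomputable def FF (D : WeylSetting) : D.W → List D.I → D.W → ℚ
  | _, [], v => if v = 1 then 1 else 0
  | g, i :: l, v => FF D (g * D.s i) l v +
      if D.IsPosRoot (D.act v⁻¹ (D.simple i)) then 0
      else D.hh (D.act g (D.simple i)) * FF D (g * D.s i) l (D.s i * v)

theorem FF_sublist : ∀ {l : List D.I} {g v : D.W}, D.FF g l v ≠ 0 →
    ∃ l', List.Sublist l' l ∧ D.wordProd l' = v := by
  intro l
  induction l with
  | nil =>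
    intro g v h
    refine ⟨[], List.Sublist.refl _, ?_⟩
    by_contra hc
    apply h
    rw [FF, if_neg]
    rintro rfl
    exact hc wordProd_nil
  | cons i l ih =>
    intro g v h
    rw [FF] at h
    by_cases h1 : D.FF (g * D.s i) l v = 0
    · rw [h1, zero_add] at h
      split_ifs at h with hp
      · exact absurd rfl h
      · obtain ⟨l', h2, h3⟩ := ih (right_ne_zero_of_mul h)
        refine ⟨i :: l', h2.cons_cons i, ?_⟩
        rw [wordProd_cons, h3, s_mul_s_mul]
    · obtain ⟨l', h2, h3⟩ := ih h1
      exact ⟨l', h2.cons i, h3⟩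

/-- positive real roots -/
noncomputable def RP (D : WeylSetting) : Finset D.V :=
  D.roots.filter fun β => D.IsPosRoot β ∧ D.IsReal β

theorem mem_RP {β : D.V} : β ∈ D.RP ↔ D.IsPosRoot β ∧ D.IsReal β := by
  unfold RP
  rw [Finset.mem_filter]
  exact ⟨fun h => h.2, fun h => ⟨h.1.1, h⟩⟩

/-- the Chevalley sum -/
noncomputable def chev (D : WeylSetting) (pi : D.V) (g : D.W) (l : List D.I) (v : D.W) : ℚ :=
  ∑ γ ∈ D.RP, if D.length (v * D.srefl γ) = D.length v + 1 then
    D.coroot γ pi * D.FF g l (v * D.srefl γ) else 0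


theorem srefl_inv_simple (v : D.W) (i : D.I) :
    v * D.srefl (D.act v⁻¹ (D.simple i)) = D.s i * v := by
  rw [srefl_conj _ (D.simple_mem i), inv_inv, s]
  group

theorem not_pos_s_mul {v : D.W} {i : D.I} (h : D.IsPosRoot (D.act v⁻¹ (D.simple i))) :
    ¬ D.IsPosRoot (D.act (D.s i * v)⁻¹ (D.simple i)) := by
  rw [act_s_mul_inv, not_pos_iff (D.roots_neg _ h.1), neg_neg]
  exact h

theorem chevalley (pi : D.V) : ∀ (l : List D.I) (g v : D.W),
    D.hh (D.act g (D.act v pi - D.act (D.wordProd l) pi)) * D.FF g l v = D.chev pi g l v := by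
  intro l
  induction l with
  | nil =>
    intro g v
    have h1 : D.chev pi g [] v = 0 := by
      unfold chev
      refine Finset.sum_eq_zero fun γ _ => ?_
      split_ifs with h
      · rw [FF, if_neg, mul_zero]
        intro h1
        rw [h1, length_one] at h
        omega
      · rfl
    rw [h1, FF, wordProd_nil]
    split_ifs with h
    · subst h; simp
    · simp
  | cons i l ih =>
    intro g v
    have hb : ∀ x, D.act (g * D.s i) x = D.act g (D.act (D.s i) x) := act_mul' _ _
    have hR : D.chev pi g (i :: l) v = D.chev pi (g * D.s i) l v +
        ∑ γ ∈ D.RP, if D.length (v * D.srefl γ) = D.length v + 1 ∧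
          ¬ D.IsPosRoot (D.act (v * D.srefl γ)⁻¹ (D.simple i)) then
          D.coroot γ pi * (D.hh (D.act g (D.simple i)) *
            D.FF (g * D.s i) l (D.s i * (v * D.srefl γ))) else 0 := by
      unfold chev
      rw [← Finset.sum_add_distrib]
      refine Finset.sum_congr rfl fun γ _ => ?_
      rw [FF]
      by_cases h1 : D.length (v * D.srefl γ) = D.length v + 1
      · by_cases h2 : D.IsPosRoot (D.act (v * D.srefl γ)⁻¹ (D.simple i))
        · simp only [h1, h2, if_true, not_true, and_false, if_false, add_zero]
        · simp only [h1, h2, if_true, not_false_eq_true, and_true, if_false, mul_add]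
      · simp [h1]
    have hL : D.hh (D.act g (D.act v pi - D.act (D.wordProd (i :: l)) pi)) =
        D.hh (D.act (g * D.s i) (D.act v pi - D.act (D.wordProd l) pi)) +
          D.coroot (D.simple i) (D.act v pi) * D.hh (D.act g (D.simple i)) := by
      rw [wordProd_cons, act_mul', hb, map_sub (D.act (D.s i)), s_apply i (D.act v pi)]
      simp only [map_sub, map_smul, smul_eq_mul]
      ring
    rw [hR, hL, FF, ← ih]
    set b := D.hh (D.act g (D.simple i)) with hbdef
    set c := D.coroot (D.simple i) (D.act v pi) with hcdef
    by_cases hp : D.IsPosRoot (D.act v⁻¹ (D.simple i))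
    · rw [if_pos hp]
      have h0 : D.act v⁻¹ (D.simple i) ∈ D.RP := mem_RP.mpr ⟨hp, (real_simple i).act _⟩
      rw [Finset.sum_eq_single_of_mem _ h0]
      · rw [srefl_inv_simple, if_pos ⟨length_s_up hp, not_pos_s_mul hp⟩, s_mul_s_mul,
          coroot_act (D.simple_mem i), inv_inv]
        ring
      · intro γ hγ hne
        obtain ⟨h1, h2⟩ := mem_RP.mp hγ
        rw [if_neg]
        rintro ⟨h3, h4⟩
        exact hne (lifting h1 h2 h3 hp h4)
    · rw [if_neg hp]
      have hlen := length_s_down hp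
      have hp' : D.IsPosRoot (D.act (D.s i * v)⁻¹ (D.simple i)) := by
        rw [act_s_mul_inv]
        exact (not_pos_iff (D.roots_invariant _ _ (D.simple_mem i))).mp hp
      have h0 : D.act (D.s i * v)⁻¹ (D.simple i) ∈ D.RP :=
        mem_RP.mpr ⟨hp', (real_simple i).act _⟩
      have hS : (∑ γ ∈ D.RP, if D.length (v * D.srefl γ) = D.length v + 1 ∧
          ¬ D.IsPosRoot (D.act (v * D.srefl γ)⁻¹ (D.simple i)) then
          D.coroot γ pi * (b * D.FF (g * D.s i) l (D.s i * (v * D.srefl γ))) else 0) =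
          b * (D.chev pi (g * D.s i) l (D.s i * v) + c * D.FF (g * D.s i) l v) := by
        unfold chev
        rw [← Finset.add_sum_erase _ _ h0, ← Finset.add_sum_erase _ _ h0]
        have e1 : v * D.srefl (D.act (D.s i * v)⁻¹ (D.simple i)) = D.s i * v := by
          have := srefl_inv_simple (D.s i * v) i
          rw [s_mul_s_mul, mul_assoc] at this
          rw [← s_mul_s_mul i (v * _), this]
        have e2 : D.s i * v * D.srefl (D.act (D.s i * v)⁻¹ (D.simple i)) = v := by
          rw [srefl_inv_simple, s_mul_s_mul]
        have e3 : D.coroot (D.act (D.s i * v)⁻¹ (D.simple i)) pi = -c := by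
          rw [coroot_act (D.simple_mem i), inv_inv, act_mul', s_apply, map_sub, map_smul,
            D.coroot_self _ (D.simple_mem i), smul_eq_mul]
          ring
        rw [e1, e2, e3, if_neg (by rintro ⟨h, _⟩; omega), if_pos hlen.symm]
        have e4 : ∀ x y z : ℚ, x = b * y → 0 + x = b * (-c * z + y + c * z) := by
          intro x y z h; rw [h]; ring
        apply e4
        rw [Finset.mul_sum]
        refine Finset.sum_congr rfl fun γ hγ => ?_
        obtain ⟨hne, hγ'⟩ := Finset.mem_erase.mp hγ
        obtain ⟨h1, h2⟩ := mem_RP.mp hγ'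
        have hiff : (D.length (v * D.srefl γ) = D.length v + 1 ∧
            ¬ D.IsPosRoot (D.act (v * D.srefl γ)⁻¹ (D.simple i))) ↔
            D.length (D.s i * v * D.srefl γ) = D.length (D.s i * v) + 1 := by
          constructor
          · rintro ⟨h3, h4⟩
            have := length_s_down h4
            rw [mul_assoc]
            omega
          · intro h3
            have h4 : D.IsPosRoot (D.act (D.s i * v * D.srefl γ)⁻¹ (D.simple i)) := by
              by_contra hc
              exact hne (lifting h1 h2 h3 hp' hc)
            have h5 := length_s_up h4
            have h6 := not_pos_s_mul h4
            rw [mul_assoc (D.s i) v, s_mul_s_mul] at h5 h6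
            rw [mul_assoc] at h3
            exact ⟨by omega, h6⟩
        rw [← mul_assoc (D.s i)]
        by_cases h3 : D.length (D.s i * v * D.srefl γ) = D.length (D.s i * v) + 1
        · rw [if_pos (hiff.mpr h3), if_pos h3]; ring
        · rw [if_neg (fun h => h3 (hiff.mp h)), if_neg h3, mul_zero]
      rw [hS, ← ih]
      have e5 : D.hh (D.act (g * D.s i) (D.act (D.s i * v) pi - D.act (D.wordProd l) pi)) =
          D.hh (D.act (g * D.s i) (D.act v pi - D.act (D.wordProd l) pi)) + c * b := by
        have e6 : D.act (g * D.s i) (D.simple i) = - D.act g (D.simple i) := by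
          rw [hb, s_simple, map_neg]
        rw [act_mul' (D.s i), s_apply]
        simp only [map_sub, map_smul, e6, map_neg, smul_eq_mul]
        rw [← hbdef, ← hcdef]
        ring
      rw [e5]
      ring


theorem sum_finset_succ {n : ℕ} (f : Finset (Fin (n + 1)) → ℚ) :
    ∑ S, f S = ∑ S : Finset (Fin n), f (S.map (Fin.succEmb n)) +
      ∑ S : Finset (Fin n), f (insert 0 (S.map (Fin.succEmb n))) := by
  have h0 : (0 : Fin (n + 1)) ∉ Finset.univ.image (Fin.succ : Fin n → Fin (n + 1)) := by
    simp
  have h1 : (Finset.univ : Finset (Finset (Fin (n + 1)))) =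
      (insert 0 (Finset.univ.image (Fin.succ : Fin n → Fin (n + 1)))).powerset := by
    rw [← Finset.powerset_univ]
    congr 1
    ext x
    simp
  rw [h1, Finset.sum_powerset_insert h0, Finset.powerset_image, Finset.powerset_univ]
  have hinj : Function.Injective (fun S : Finset (Fin n) => S.image (Fin.succ)) :=
    Finset.image_injective (Fin.succ_injective n)
  rw [Finset.sum_image (fun a _ b _ h => hinj h), Finset.sum_image (fun a _ b _ h => hinj h)]
  simp only [Finset.map_eq_image]
  rfl

theorem subwordF_succ (i : D.I) (l : List D.I) (S : Finset (Fin l.length)) :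
    D.subwordF (i :: l) (S.map (Fin.succEmb _)) = D.subwordF l S := by
  unfold subwordF
  simp only [List.length_cons]
  rw [List.finRange_succ, List.filter_cons_of_neg (by simp [Fin.succ_ne_zero]), List.filter_map,
    List.map_map]
  congr 1
  apply List.filter_congr
  intro j _
  simp

theorem subwordF_insert (i : D.I) (l : List D.I) (S : Finset (Fin l.length)) :
    D.subwordF (i :: l) (insert 0 (S.map (Fin.succEmb _))) = i :: D.subwordF l S := by
  unfold subwordF
  simp only [List.length_cons]
  rw [List.finRange_succ, List.filter_cons_of_pos (by simp), List.filter_map,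
    List.map_cons, List.map_map]
  congr 2
  apply List.filter_congr
  intro j _
  simp [Fin.succ_ne_zero]

theorem subwordF_length (l : List D.I) : ∀ (S : Finset (Fin l.length)),
    (D.subwordF l S).length = S.card := by
  intro S
  unfold subwordF
  rw [List.length_map, ← List.toFinset_card_of_nodup ((List.nodup_finRange _).filter _)]
  congr 1
  ext j
  simp

theorem sum_eq_FF : ∀ (l : List D.I) (g v : D.W),
    (∑ S : Finset (Fin l.length),
      if D.wordProd (D.subwordF l S) = v ∧ S.card = D.length v then
        ∏ j ∈ S, D.hh (D.act g (D.refRoot l j)) else 0) = D.FF g l v := by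
  intro l
  induction l with
  | nil =>
    intro g v
    rw [FF]
    have : (Finset.univ : Finset (Finset (Fin ([] : List D.I).length))) = {∅} := by
      ext S
      simp only [Finset.mem_univ, Finset.mem_singleton, true_iff]
      ext x
      exact x.elim0
    rw [this, Finset.sum_singleton]
    have h1 : D.wordProd (D.subwordF [] ∅) = 1 := by simp [subwordF, wordProd]
    rw [h1]
    by_cases hv : v = 1
    · subst hv; simp [length_one]
    · rw [if_neg hv, if_neg]
      rintro ⟨h, _⟩
      exact hv h.symm
  | cons i l ih =>
    intro g v
    rw [FF, ← ih, ← ih]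
    have hr : ∀ j : Fin l.length, D.act g (D.refRoot (i :: l) j.succ) =
        D.act (g * D.s i) (D.refRoot l j) := by
      intro j
      simp only [refRoot, Fin.val_succ, List.take_succ_cons, wordProd_cons, act_mul']
      rfl
    have hr0 : D.act g (D.refRoot (i :: l) (0 : Fin (l.length + 1))) = D.act g (D.simple i) := by
      simp only [refRoot, Fin.val_zero, List.take_zero, wordProd_nil, act_one']
      rfl
    refine (sum_finset_succ (n := l.length) _).trans ?_
    congr 1
    · refine Finset.sum_congr rfl fun S _ => ?_
      rw [subwordF_succ, Finset.card_map, Finset.prod_map]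
      simp only [Fin.coe_succEmb, hr]
    · have hterm : ∀ S : Finset (Fin l.length),
          (insert 0 (S.map (Fin.succEmb _)) : Finset (Fin (l.length + 1))).card = S.card + 1 ∧
          ∏ j ∈ (insert 0 (S.map (Fin.succEmb _)) : Finset (Fin (l.length + 1))),
            D.hh (D.act g (D.refRoot (i :: l) j)) = D.hh (D.act g (D.simple i)) *
              ∏ j ∈ S, D.hh (D.act (g * D.s i) (D.refRoot l j)) := by
        intro S
        have h0 : (0 : Fin (l.length + 1)) ∉ S.map (Fin.succEmb _) := by
          simp [Fin.succ_ne_zero]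
        constructor
        · rw [Finset.card_insert_of_notMem h0, Finset.card_map]
        · refine (Finset.prod_insert h0).trans ?_
          rw [Finset.prod_map, hr0]
          simp only [Fin.coe_succEmb, hr]
      by_cases hp : D.IsPosRoot (D.act v⁻¹ (D.simple i))
      · rw [if_pos hp]
        refine Finset.sum_eq_zero fun S _ => ?_
        rw [if_neg]
        rintro ⟨h1, h2⟩
        rw [subwordF_insert, wordProd_cons] at h1
        have h3 := length_s_up hp
        rw [← h1, s_mul_s_mul, h1] at h3
        have h4 := D.length_le (D.subwordF l S)
        rw [subwordF_length] at h4
        have h5 := (hterm S).1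
        omega
      · rw [if_neg hp, Finset.mul_sum]
        refine Finset.sum_congr rfl fun S _ => ?_
        have h3 := length_s_down hp
        rw [subwordF_insert, wordProd_cons]
        have hiff : (D.s i * D.wordProd (D.subwordF l S) = v ∧
            (insert 0 (S.map (Fin.succEmb _)) : Finset (Fin (l.length + 1))).card = D.length v) ↔
            (D.wordProd (D.subwordF l S) = D.s i * v ∧ S.card = D.length (D.s i * v)) := by
          rw [(hterm S).1]
          constructor
          · rintro ⟨h1, h2⟩
            exact ⟨by rw [← h1, s_mul_s_mul], by omega⟩
          · rintro ⟨h1, h2⟩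
            exact ⟨by rw [h1, s_mul_s_mul], by omega⟩
        by_cases hc : D.wordProd (D.subwordF l S) = D.s i * v ∧ S.card = D.length (D.s i * v)
        · rw [if_pos hc]
          refine (if_pos (hiff.mpr hc)).trans ?_
          exact (hterm S).2
        · rw [if_neg hc, mul_zero]
          exact if_neg (fun h => hc (hiff.mp h))

theorem refRoot_pos {l : List D.I} (hup : D.Up 1 l) (j : Fin l.length) :
    D.IsPosRoot (D.refRoot l j) := by
  have hsplit : l = l.take j ++ (l.get j :: l.drop (j + 1)) := by
    simp
  have hl := up_one.mp hup
  rw [refRoot]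
  generalize hi : l.get j = i at *
  generalize l.take j = a at *
  generalize l.drop (j + 1) = b at *
  rw [hsplit, wordProd_append, wordProd_cons, List.length_append, List.length_cons,
    ← mul_assoc] at hl
  have h1 := length_mul_le (D.wordProd a * D.s i) (D.wordProd b)
  have h2 := D.length_le b
  have h3 := D.length_le a
  have h4 := length_mul_le (D.wordProd a) (D.s i)
  have h5 := D.length_s_le i
  have h6 : D.length (D.s i * (D.wordProd a)⁻¹) = D.length (D.wordProd a)⁻¹ + 1 := by
    rw [← length_inv, mul_inv_rev, inv_inv, s_inv, length_inv]
    omega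
  have h7 := s_up_iff.mpr h6
  rwa [inv_inv] at h7

theorem FF_self {l : List D.I} (hup : D.Up 1 l) :
    D.FF 1 l (D.wordProd l) = ∏ j : Fin l.length, D.hh (D.refRoot l j) := by
  have hl := up_one.mp hup
  rw [← sum_eq_FF, Finset.sum_eq_single_of_mem Finset.univ (Finset.mem_univ _)]
  · rw [if_pos]
    · simp only [act_one']
    · constructor
      · unfold subwordF
        simp
      · simp [← hl]
  · intro S _ hS
    rw [if_neg]
    rintro ⟨_, h2⟩
    apply hS
    rw [← Finset.card_eq_iff_eq_univ, h2, Fintype.card_fin, hl]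

theorem finite_red (x : D.W) : Finite {l : List D.I // D.IsReduced l x} := by
  have : Set.Finite {l : List D.I | l.length = D.length x} := List.finite_length_eq _ _
  exact (this.subset (fun l (hl : D.IsReduced l x) => hl.2)).to_subtype

theorem redCard_one : D.RedCard (1 : D.W) = 1 := by
  unfold RedCard
  rw [Nat.card_eq_one_iff_unique]
  refine ⟨⟨fun a b => ?_⟩, ⟨⟨[], wordProd_nil, by rw [length_one]; rfl⟩⟩⟩
  have h1 := a.2.2
  have h2 := b.2.2
  rw [length_one, List.length_eq_zero_iff] at h1 h2
  exact Subtype.ext (h1.trans h2.symm)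

theorem redCard_rec {x : D.W} (hx : D.length x ≠ 0) :
    D.RedCard x = ∑ i, if D.length (x * D.s i) < D.length x then D.RedCard (x * D.s i) else 0 := by
  have hfin : ∀ i : D.I, Finite {l : List D.I //
      D.IsReduced l (x * D.s i) ∧ D.length (x * D.s i) < D.length x} := fun i => by
    have := finite_red (x * D.s i)
    exact Finite.of_injective (fun l => (⟨l.1, l.2.1⟩ : {l // D.IsReduced l (x * D.s i)}))
      (fun a b h => Subtype.ext (Subtype.mk.inj h))
  have hss : ∀ i : D.I, x * D.s i * D.s i = x := fun i => by rw [mul_assoc, s_sq, mul_one]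
  have hle : ∀ i : D.I, D.length x ≤ D.length (x * D.s i) + 1 := fun i => by
    have := length_mul_le (x * D.s i) (D.s i)
    rw [hss] at this
    have := D.length_s_le i
    omega
  have hcard : Nat.card (Σ i : D.I, {l : List D.I //
      D.IsReduced l (x * D.s i) ∧ D.length (x * D.s i) < D.length x}) = D.RedCard x := by
    unfold RedCard
    refine Nat.card_congr (Equiv.ofBijective (fun p => ⟨p.2.1 ++ [p.1], ?_, ?_⟩) ⟨?_, ?_⟩)
    · rw [wordProd_append, wordProd_single, p.2.2.1.1, hss]
    · have h1 := p.2.2.1.2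
      have h2 := p.2.2.2
      have h3 := hle p.1
      rw [List.length_append, List.length_singleton]
      omega
    · rintro ⟨i, l, hl⟩ ⟨j, m, hm⟩ h
      obtain ⟨h1, h2⟩ := List.append_inj' (Subtype.mk.inj h) rfl
      simp only [List.cons.injEq, and_true] at h2
      subst h1
      subst h2
      rfl
    · rintro ⟨l, h1, h2⟩
      rcases List.eq_nil_or_concat l with rfl | ⟨m, i, rfl⟩
      · exact absurd h2.symm hx
      · rw [List.concat_eq_append, wordProd_append, wordProd_single] at h1
        rw [List.concat_eq_append, List.length_append, List.length_singleton] at h2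
        have h3 : x * D.s i = D.wordProd m := by rw [← h1, mul_assoc, s_sq, mul_one]
        have h4 := D.length_le m
        have h5 := hle i
        rw [← h3] at h4
        refine ⟨⟨i, m, ⟨h3.symm, by omega⟩, by omega⟩, ?_⟩
        simp
  rw [← hcard, Nat.card_sigma]
  refine Finset.sum_congr rfl fun i _ => ?_
  split_ifs with h
  · unfold RedCard
    simp only [h, and_true]
  · have : IsEmpty {l : List D.I //
      D.IsReduced l (x * D.s i) ∧ D.length (x * D.s i) < D.length x} := ⟨fun l => h l.2.2⟩
    exact Nat.card_of_isEmpty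

theorem main_ind {pi : D.V} (hpi : D.IsDominant pi) {l : List D.I} (hl : D.Up 1 l)
    (hmin : D.MinInv pi (D.wordProd l)) : ∀ (n : ℕ) (m : List D.I) (v : D.W), m.length = n →
    D.Up v m → D.wordProd m * v = D.wordProd l →
    (D.RedCard (D.wordProd l * v⁻¹) : ℚ) * D.FF 1 l (D.wordProd l) =
      (n.factorial : ℚ) * D.FF 1 l v := by
  intro n
  induction n with
  | zero =>
    intro m v hm _ hw
    rw [List.length_eq_zero_iff] at hm
    subst hm
    rw [wordProd_nil, one_mul] at hw
    rw [hw, mul_inv_cancel, redCard_one]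
    simp
  | succ n ih =>
    intro m v hm hup hw
    have hx : D.wordProd l * v⁻¹ = D.wordProd m := by rw [← hw, mul_inv_cancel_right]
    have hlenw : D.length (D.wordProd l) = m.length + D.length v := by rw [← hw]; exact hup
    have hlenx : D.length (D.wordProd m) = m.length := by
      have h1 := length_mul_le (D.wordProd m) v
      have h2 := D.length_le m
      rw [hw] at h1
      omega
    have hminv : D.MinInv pi v := minInv_of_up hup (by rwa [hw])
    -- data for a descent
    have hdesc : ∀ i, D.length (D.wordProd m * D.s i) < D.length (D.wordProd m) →
        D.IsPosRoot (D.act v⁻¹ (D.simple i)) ∧ ∃ m', m'.length = n ∧ D.Up (D.s i * v) m' ∧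
          D.wordProd m' * (D.s i * v) = D.wordProd l := by
      intro i hi
      obtain ⟨m', h1, h2⟩ := exists_reduced (D.wordProd m * D.s i)
      have h3 : D.wordProd m' * (D.s i * v) = D.wordProd l := by
        rw [h1, mul_assoc, s_mul_s_mul, hw]
      have h4 := length_mul_le (D.wordProd m') (D.s i * v)
      have h5 := D.length_le m'
      have h6 := length_s_mul_le i v
      rw [h3] at h4
      refine ⟨s_up_iff.mpr (by omega), m', by omega, ?_, h3⟩
      unfold Up
      rw [h3]
      omega
    have hch := chevalley pi l 1 v
    rw [act_one'] at hch
    have hht := hh_chain hup (pi := pi) (by rwa [hw])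
    rw [hw] at hht
    rw [hht] at hch
    have hsum : D.chev pi 1 l v = ∑ i, if D.length (D.wordProd m * D.s i) < D.length (D.wordProd m)
        then D.FF 1 l (D.s i * v) else 0 := by
      unfold chev
      rw [← Finset.sum_filter, ← Finset.sum_filter]
      symm
      refine Finset.sum_of_injOn (fun i => D.act v⁻¹ (D.simple i)) ?_ ?_ ?_ ?_
      · intro i _ j _ h
        exact D.simple_indep.injective ((D.act v⁻¹).injective h)
      · intro i hi
        have hi' := (Finset.mem_filter.mp hi).2
        obtain ⟨h1, _⟩ := hdesc i hi'
        refine Finset.mem_coe.mpr (Finset.mem_filter.mpr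
          ⟨mem_RP.mpr ⟨h1, (real_simple i).act _⟩, ?_⟩)
        rw [srefl_inv_simple]
        exact length_s_up h1
      · intro γ hγ hnot
        obtain ⟨hγ1, hcov⟩ := Finset.mem_filter.mp hγ
        obtain ⟨hpos, hreal⟩ := mem_RP.mp hγ1
        by_contra hne
        have hc0 := left_ne_zero_of_mul hne
        obtain ⟨l', hs, hu⟩ := FF_sublist (right_ne_zero_of_mul hne)
        have hvwp := inWP_of_minInv hminv
        have huwp : D.InWP pi (v * D.srefl γ) := by
          intro j hj h0
          have hvj : D.IsPosRoot (D.act v (D.simple j)) := by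
            by_contra hc
            exact hvwp j hc h0
          have hvγ := pos_of_length_lt (v := v) hpos (by omega)
          have he : v⁻¹ * D.srefl (D.act v γ) = (v * D.srefl γ)⁻¹ := by
            rw [mul_srefl v⁻¹ hvγ.1, act_inv_act, mul_inv_rev, srefl_inv hpos.1]
          have h1 := lifting (v := v⁻¹) (i := j) hvγ (hreal.act v)
            (by rw [he, length_inv, length_inv]; exact hcov) (by rwa [inv_inv])
            (by rwa [he, inv_inv])
          rw [inv_inv] at h1
          rw [(D.act v).injective h1] at hc0
          exact hc0 h0
        rw [← hu] at huwp
        obtain ⟨m2, hm2, hw2⟩ := lemmaB hpi hl hmin hs huwp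
        rw [hu] at hm2 hw2
        have hminu : D.MinInv pi (v * D.srefl γ) := minInv_of_up hm2 (by rwa [hw2])
        obtain ⟨lu, hlu1, hlu2⟩ := exists_reduced (v * D.srefl γ)
        have hvγ := pos_of_length_lt (v := v) hpos (by omega)
        have hsub : ∃ lv, List.Sublist lv lu ∧ D.wordProd lv = v := by
          obtain ⟨lv, h1, _, h2⟩ := exchange lu hvγ (by
            rw [hlu1, mul_inv_rev, srefl_inv hpos.1, act_mul', act_inv_act,
              act_srefl_self hpos.1, not_pos_iff (D.roots_neg _ hpos.1), neg_neg]
            exact hpos)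
          refine ⟨lv, h1, ?_⟩
          rw [h2, hlu1, mul_srefl v hpos.1, ← mul_assoc, srefl_sq hvγ.1, one_mul]
        obtain ⟨lv, hlv1, hlv2⟩ := hsub
        obtain ⟨m3, h3, h4⟩ := lemmaB hpi (l := lu) (l' := lv)
          (up_one.mpr (by rw [hlu2, hlu1])) (by rwa [hlu1]) hlv1 (by rwa [hlv2])
        rw [hlv2, hlu1] at h4
        rw [hlv2, Up, h4, hcov] at h3
        obtain ⟨i, rfl⟩ := List.length_eq_one_iff.mp (show m3.length = 1 by omega)
        rw [wordProd_single] at h4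
        have hvi : D.IsPosRoot (D.act v⁻¹ (D.simple i)) := s_up_iff.mpr (by rw [h4]; exact hcov)
        have hγi : γ = D.act v⁻¹ (D.simple i) := by
          refine lifting hpos hreal hcov hvi ?_
          rw [← h4]
          exact not_pos_s_mul hvi
        apply hnot
        refine ⟨i, Finset.mem_coe.mpr (Finset.mem_filter.mpr ⟨Finset.mem_univ _, ?_⟩), hγi.symm⟩
        have h5 : D.wordProd m * D.s i = D.wordProd m2 := by
          have : D.wordProd m2 * (D.s i * v) = D.wordProd m * v := by rw [h4, hw2, hw]
          rw [← mul_assoc] at this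
          rw [← mul_right_cancel this, mul_assoc, s_sq, mul_one]
        have h6 := D.length_le m2
        rw [Up, hw2, hcov] at hm2
        rw [h5]
        omega
      · intro i hi
        have hi' := (Finset.mem_filter.mp hi).2
        obtain ⟨h1, m', _, h2, h3⟩ := hdesc i hi'
        have hmi : D.MinInv pi (D.s i * v) := minInv_of_up h2 (by rwa [h3])
        have h4 := (minInv_step h1 hmi).2
        rw [srefl_inv_simple, coroot_act (D.simple_mem i), inv_inv, h4, one_mul]
    rw [hsum] at hch
    rw [hx, redCard_rec (by omega)]
    push_cast
    rw [Finset.sum_mul, Nat.factorial_succ, Nat.cast_mul, mul_comm ((n + 1 : ℕ) : ℚ), mul_assoc,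
      ← hm, hch, Finset.mul_sum]
    refine Finset.sum_congr rfl fun i _ => ?_
    split_ifs with hi
    · obtain ⟨_, m', h1, h2, h3⟩ := hdesc i hi
      have := ih m' (D.s i * v) h1 h2 h3
      rw [mul_inv_rev, s_inv, ← mul_assoc, hx] at this
      exact this
    · simp


end Proof

end WeylSetting
/-- For `π`-minuscule `v ≤ w` in `W^P` and a fixed reduced word
`w = s_{i_1} ⋯ s_{i_ℓ}` with `β_j = s_{i_1} ⋯ s_{i_{j-1}}(α_{i_j})`:
`#Red(w v⁻¹) = (ℓ(w)-ℓ(v))! ⋅ (Σ ht(β_{j_1}) ⋯ ht(β_{j_{ℓ(v)}})) / (ht(β₁) ⋯ ht(β_ℓ))`,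
the sum being over all subsequences giving reduced decompositions of `v`. -/
theorem skew_red_count_general
    (D : WeylSetting) (pi : D.V) (hpi : D.IsDominant pi)
    (v w : D.W) (hv : D.IsMinuscule pi v) (hw : D.IsMinuscule pi w)
    (hvr : D.IsMinRep (D.stab pi) v) (hwr : D.IsMinRep (D.stab pi) w)
    (hvw : D.bruhatLE v w)
    (l : List D.I) (hl : D.IsReduced l w) :
    (D.RedCard (w * v⁻¹) : ℚ) * ∏ j : Fin l.length, (D.ht (D.refRoot l j) : ℚ) =
      (D.length w - D.length v).factorial *
        ∑ S : Finset (Fin l.length),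
          if D.wordProd (D.subwordF l S) = v ∧ S.card = D.length v then
            ∏ j ∈ S, (D.ht (D.refRoot l j) : ℚ) else 0 := by
  have hup : D.Up 1 l := WeylSetting.up_one.mpr (by rw [hl.1, hl.2])
  have hmin : D.MinInv pi (D.wordProd l) := by
    rw [hl.1]; exact WeylSetting.minInv_of_minuscule hw
  obtain ⟨l', hs, hl'⟩ := WeylSetting.bruhat_sublist hvw l hl.1
  obtain ⟨m, hm, hmw⟩ := WeylSetting.lemmaB hpi hup hmin hs
    (by rw [hl']; exact WeylSetting.inWP_of_minrep hvr)
  rw [hl'] at hm hmw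
  have hfin := WeylSetting.main_ind hpi hup hmin m.length m v rfl hm hmw
  have hlen : D.length w - D.length v = m.length := by
    rw [WeylSetting.Up, hmw, hl.1] at hm
    omega
  have hht : ∀ j : Fin l.length, (D.ht (D.refRoot l j) : ℚ) = D.hh (D.refRoot l j) :=
    fun j => WeylSetting.ht_eq (WeylSetting.refRoot_pos hup j)
  rw [WeylSetting.FF_self hup, hl.1, ← WeylSetting.sum_eq_FF] at hfin
  simp only [WeylSetting.act_one'] at hfin
  rw [hlen]
  simp only [hht]
  exact hfin
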